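/- arXiv:2204.09326 — 2 statements merged into one kernel-verified Lean document; each statement's English description precedes it below -/
import Mathlib

section
/- There exists a countably infinite graph G = (V, E) with edge-disjoint spanning trees T₀ and T₁ and a bipartition E(T₀) = X₀ ∪ X₁ of the edge set of T₀ such that there are no edge-disjoint spanning trees S₀ and S₁ of G with E(T₀) ∩ E(Sᵢ) = Xᵢ for i ∈ {0, 1}. In other words, Greene's symmetric subset base exchange theorem fails for finite-cycle matroids of infinite graphs. -/
open SimpleGraph

/-- The graph joining every vertex to its image under a parent map. -/
def parentGraph {V : Type*} (p : V → V) : SimpleGraph V :=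
  SimpleGraph.fromRel fun v w => p v = w

theorem parentGraph_adj {V : Type*} {p : V → V} {v w : V} :
    (parentGraph p).Adj v w ↔ v ≠ w ∧ (p v = w ∨ p w = v) :=
  SimpleGraph.fromRel_adj _ _ _

/-- In a preconnected graph, a set of vertices that contains a vertex and is closed under adjacency
contains every vertex. -/
theorem SimpleGraph.Preconnected.mem_of_closed {V : Type*} {G : SimpleGraph V}
    (hG : G.Preconnected) {s : Set V} (hs : ∀ v w, G.Adj v w → v ∈ s → w ∈ s)
    {u : V} (hu : u ∈ s) (x : V) : x ∈ s := by
  obtain ⟨W⟩ := hG u x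
  induction W with
  | nil => exact hu
  | cons h _ ih => exact ih (hs _ _ h hu)

/-- A parent map that fixes a root and strictly decreases a rank elsewhere defines a tree. -/
theorem parentGraph_isTree {V : Type*} {p : V → V} (root : V) (rank : V → ℕ)
    (hroot : p root = root) (hp : ∀ v, v ≠ root → rank (p v) < rank v) :
    (parentGraph p).IsTree := by
  have hreach : ∀ n v, rank v = n → (parentGraph p).Reachable v root := by
    intro n
    induction n using Nat.strong_induction_on with
    | _ n ih =>
      rintro v rfl
      by_cases hv : v = root
      · rw [hv]
      · have hlt := hp v hv
        have hadj : (parentGraph p).Adj v (p v) :=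
          parentGraph_adj.2 ⟨fun h => by rw [← h] at hlt; exact lt_irrefl _ hlt, Or.inl rfl⟩
        exact hadj.reachable.trans (ih _ hlt _ rfl)
  have hle : ∀ v, rank (p v) ≤ rank v := fun v => by
    by_cases hv : v = root
    · rw [hv, hroot]
    · exact (hp v hv).le
  have hiter : ∀ k v, rank (p^[k] v) ≤ rank v := by
    intro k
    induction k with
    | zero => exact fun v => le_rfl
    | succ k ih => exact fun v => (ih (p v)).trans (hle v)
  have hbridge : ∀ v, v ≠ p v →
      ¬ ((parentGraph p).deleteEdges {s(v, p v)}).Reachable v (p v) := by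
    rintro v hv ⟨W⟩
    have hroot_ne : v ≠ root := by rintro rfl; exact hv hroot.symm
    have key : ∀ {a b : V}, ((parentGraph p).deleteEdges {s(v, p v)}).Walk a b →
        (∃ k, p^[k] a = v) → ∃ k, p^[k] b = v := by
      intro a b W
      induction W with
      | nil => exact id
      | @cons a c b h _ ih =>
        rintro ⟨k, hk⟩
        apply ih
        rw [SimpleGraph.deleteEdges_adj, parentGraph_adj] at h
        obtain ⟨⟨_, rfl | rfl⟩, hdel⟩ := h
        · cases k with
          | zero => exact absurd (by rw [← hk]; rfl) hdel
          | succ k => exact ⟨k, hk⟩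
        · exact ⟨k + 1, hk⟩
    obtain ⟨k, hk⟩ := key W ⟨0, rfl⟩
    have h₁ := hiter k (p v)
    rw [hk] at h₁
    exact absurd (hp v hroot_ne) (not_lt.2 h₁)
  have : Nonempty V := ⟨root⟩
  refine ⟨⟨fun v w => (hreach _ v rfl).trans (hreach _ w rfl).symm⟩, ?_⟩
  rw [SimpleGraph.isAcyclic_iff_forall_adj_isBridge]
  intro v w h
  rw [parentGraph_adj] at h
  obtain ⟨hne, rfl | rfl⟩ := h
  · exact SimpleGraph.isBridge_iff.2 (hbridge v hne)
  · rw [Sym2.eq_swap]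
    exact SimpleGraph.isBridge_iff.2 (hbridge w hne.symm)

/-- The parent map of the comb whose spine is the ray of left vertices and whose teeth join the
two vertices with the same index. -/
def leftCombParent : ℕ ⊕ ℕ → ℕ ⊕ ℕ
  | .inl n => .inl (n - 1)
  | .inr n => .inl n

/-- The parent map of the comb whose spine is the ray of right vertices and whose teeth join the
left vertex `n` to the right vertex `n + 2`. -/
def rightCombParent : ℕ ⊕ ℕ → ℕ ⊕ ℕ
  | .inl n => .inr (n + 2)
  | .inr n => .inr (n - 1)

theorem leftComb_isTree : (parentGraph leftCombParent).IsTree := by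
  refine parentGraph_isTree (.inl 0) (Sum.elim id (· + 1)) rfl ?_
  rintro (n | n) h
  · have : n ≠ 0 := by rintro rfl; exact h rfl
    simp [leftCombParent]; omega
  · simp [leftCombParent]

theorem rightComb_isTree : (parentGraph rightCombParent).IsTree := by
  refine parentGraph_isTree (.inr 0) (Sum.elim (· + 3) id) rfl ?_
  rintro (n | n) h
  · simp [rightCombParent]
  · have : n ≠ 0 := by rintro rfl; exact h rfl
    simp [rightCombParent]; omega

theorem leftComb_edgeSet :
    Set.range (fun n : ℕ => s((.inl n : ℕ ⊕ ℕ), .inr n)) ∪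
      Set.range (fun n : ℕ => s((.inl n : ℕ ⊕ ℕ), .inl (n + 1))) =
      (parentGraph leftCombParent).edgeSet := by
  ext e
  induction e using Sym2.ind with
  | _ v w =>
    simp only [Set.mem_union, Set.mem_range, SimpleGraph.mem_edgeSet, parentGraph_adj,
      Sym2.eq_iff]
    rcases v with m | m <;> rcases w with n | n <;> simp [leftCombParent]
    · constructor
      · rintro ⟨y, ⟨rfl, rfl⟩ | ⟨rfl, rfl⟩⟩ <;> omega
      · rintro ⟨h, h' | h'⟩
        · exact ⟨n, Or.inr ⟨rfl, by omega⟩⟩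
        · exact ⟨m, Or.inl ⟨rfl, by omega⟩⟩
    all_goals exact eq_comm

/-- **Theorem (failure of Greene's theorem for infinite graphs).**
There is a countably infinite graph `G` with edge-disjoint spanning trees `T₀` and
`T₁` and a bipartition `E(T₀) = X₀ ∪ X₁` such that there are no edge-disjoint
spanning trees `S₀` and `S₁` of `G` with `E(T₀) ∩ E(Sᵢ) = Xᵢ` for `i ∈ {0, 1}`.
Spanning trees of `G` are formalized as subgraphs on the full vertex set (i.e.
simple graphs `T ≤ G`) that are trees (connected and acyclic). -/
theorem greene_fails_for_infinite_graphs :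
    ∃ (V : Type) (G : SimpleGraph V), Countable V ∧ Infinite V ∧
      ∃ T₀ T₁ : SimpleGraph V, T₀ ≤ G ∧ T₁ ≤ G ∧ T₀.IsTree ∧ T₁.IsTree ∧
        Disjoint T₀.edgeSet T₁.edgeSet ∧
        ∃ X₀ X₁ : Set (Sym2 V), Disjoint X₀ X₁ ∧ X₀ ∪ X₁ = T₀.edgeSet ∧
          ¬ ∃ S₀ S₁ : SimpleGraph V, S₀ ≤ G ∧ S₁ ≤ G ∧ S₀.IsTree ∧ S₁.IsTree ∧
              Disjoint S₀.edgeSet S₁.edgeSet ∧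
              T₀.edgeSet ∩ S₀.edgeSet = X₀ ∧ T₀.edgeSet ∩ S₁.edgeSet = X₁ := by
  refine ⟨ℕ ⊕ ℕ, parentGraph leftCombParent ⊔ parentGraph rightCombParent, inferInstance,
    inferInstance, _, _, le_sup_left, le_sup_right, leftComb_isTree, rightComb_isTree, ?_, _, _,
    ?_, leftComb_edgeSet, ?_⟩
  · rw [Set.disjoint_left]
    intro e
    induction e using Sym2.ind with
    | _ v w =>
      simp only [SimpleGraph.mem_edgeSet, parentGraph_adj]
      rcases v with m | m <;> rcases w with n | n <;>
        simp [leftCombParent, rightCombParent] <;> omega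
  · rw [Set.disjoint_left]
    rintro _ ⟨m, rfl⟩ ⟨n, h⟩
    simp at h
  · rintro ⟨S₀, S₁, hS₀, hS₁, ht₀, ht₁, hdisj, hX₀, hX₁⟩
    have hdis : ∀ v w, S₀.Adj v w → S₁.Adj v w → False := fun v w h₀ h₁ =>
      Set.disjoint_left.1 hdisj (show s(v, w) ∈ S₀.edgeSet from h₀) h₁
    have hrung : ∀ n, S₀.Adj (.inl n) (.inr n) := fun n => by
      have h : s((.inl n : ℕ ⊕ ℕ), .inr n) ∈ _ := hX₀.symm.subset ⟨n, rfl⟩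
      exact h.2
    have hspine : ∀ n, S₁.Adj (.inl n) (.inl (n + 1)) := fun n => by
      have h : s((.inl n : ℕ ⊕ ℕ), .inl (n + 1)) ∈ _ := hX₁.symm.subset ⟨n, rfl⟩
      exact h.2
    have hll : ∀ m n, ¬ S₀.Adj (.inl m) (.inl n) := fun m n h => by
      have hG := hS₀ h
      simp [parentGraph_adj, leftCombParent, rightCombParent] at hG
      obtain ⟨hne, h' | h'⟩ := hG
      · obtain rfl : m = n + 1 := by omega
        exact hdis _ _ h.symm (hspine n)
      · obtain rfl : n = m + 1 := by omega
        exact hdis _ _ h (hspine m)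
    have hlr : ∀ {S : SimpleGraph (ℕ ⊕ ℕ)},
        S ≤ parentGraph leftCombParent ⊔ parentGraph rightCombParent →
        ∀ {m n}, S.Adj (.inl m) (.inr n) → n = m ∨ n = m + 2 := fun hS m n h => by
      have hG := hS h
      simp [parentGraph_adj, leftCombParent, rightCombParent] at hG
      omega
    have hrr : ∀ {S : SimpleGraph (ℕ ⊕ ℕ)},
        S ≤ parentGraph leftCombParent ⊔ parentGraph rightCombParent →
        ∀ {m n}, S.Adj (.inr m) (.inr n) → n = m + 1 ∨ m = n + 1 := fun hS m n h => by
      have hG := hS h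
      simp [parentGraph_adj, leftCombParent, rightCombParent] at hG
      omega
    have hforced : ∀ n, S₁.Adj (.inr n) (.inr (n + 1)) ∧ S₀.Adj (.inl n) (.inr (n + 2)) := by
      intro n
      induction n using Nat.strong_induction_on with
      | _ n ih =>
        have hright : S₁.Adj (.inr n) (.inr (n + 1)) := by
          by_contra hcon
          have hclosed : ∀ v w, S₁.Adj v w → v ∈ {x | ∃ i ≤ n, x = Sum.inr i} →
              w ∈ {x : ℕ ⊕ ℕ | ∃ i ≤ n, x = Sum.inr i} := by
            rintro _ (j | j) h ⟨i, hi, rfl⟩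
            · obtain rfl | rfl := hlr hS₁ h.symm
              · exact (hdis _ _ (hrung _) h.symm).elim
              · exact (hdis _ _ (ih j (by omega)).2 h.symm).elim
            · obtain rfl | rfl := hrr hS₁ h
              · rcases hi.lt_or_eq with hlt | rfl
                · exact ⟨_, hlt, rfl⟩
                · exact absurd h hcon
              · exact ⟨j, by omega, rfl⟩
          obtain ⟨i, -, h⟩ := ht₁.1.preconnected.mem_of_closed hclosed ⟨n, le_rfl, rfl⟩ (.inl 0)
          simp at h
        refine ⟨hright, ?_⟩
        have hright_le : ∀ m ≤ n, S₁.Adj (.inr m) (.inr (m + 1)) := fun m hm => by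
          rcases hm.lt_or_eq with hlt | rfl
          · exact (ih m hlt).1
          · exact hright
        by_contra hcon
        have hclosed : ∀ v w, S₀.Adj v w →
            v ∈ {x | ∃ i ≤ n, i % 2 = n % 2 ∧ (x = Sum.inl i ∨ x = Sum.inr i)} →
            w ∈ {x : ℕ ⊕ ℕ | ∃ i ≤ n, i % 2 = n % 2 ∧ (x = Sum.inl i ∨ x = Sum.inr i)} := by
          rintro _ (j | j) h ⟨i, hi, hpar, rfl | rfl⟩
          · exact absurd h (hll _ _)
          · obtain rfl | rfl := hlr hS₀ h.symm
            · exact ⟨_, hi, hpar, Or.inl rfl⟩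
            · exact ⟨j, by omega, by omega, Or.inl rfl⟩
          · obtain rfl | rfl := hlr hS₀ h
            · exact ⟨_, hi, hpar, Or.inr rfl⟩
            · have hne : i ≠ n := by rintro rfl; exact hcon h
              exact ⟨i + 2, by omega, by omega, Or.inr rfl⟩
          · obtain rfl | rfl := hrr hS₀ h
            · exact (hdis _ _ h (hright_le i hi)).elim
            · exact (hdis _ _ h.symm (hright_le j (by omega))).elim
        obtain ⟨i, hi, -, h | h⟩ := ht₀.1.preconnected.mem_of_closed hclosed
          ⟨n, le_rfl, rfl, Or.inl rfl⟩ (.inl (n + 1))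
        · simp at h; omega
        · simp at h
    have hclosed : ∀ v w, S₁.Adj v w → v ∈ Set.range Sum.inr →
        w ∈ Set.range (Sum.inr : ℕ → ℕ ⊕ ℕ) := by
      rintro _ (j | j) h ⟨i, rfl⟩
      · obtain rfl | rfl := hlr hS₁ h.symm
        · exact (hdis _ _ (hrung _) h.symm).elim
        · exact (hdis _ _ (hforced j).2 h.symm).elim
      · exact ⟨j, rfl⟩
    obtain ⟨i, h⟩ := ht₁.1.preconnected.mem_of_closed hclosed ⟨0, rfl⟩ (.inl 0)
    simp at h
end

section
/- (Edmonds–Fulkerson augmenting path lemma.) Let {Mᵢ : i < κ} be a family of matroids defined on the common ground set E, let {Iᵢ : i < κ} be a family of pairwise disjoint subsets of E such that Iᵢ is independent in Mᵢ for each i, and suppose U := E \ ⋃_{i<κ} Iᵢ is nonempty. Then either there is another family {Jᵢ : i < κ} of pairwise disjoint sets, with Jᵢ independent in Mᵢ for each i, and an element e ∈ U such that ⋃_{i<κ} Jᵢ = {e} ∪ ⋃_{i<κ} Iᵢ; or there is a set S with U ⊆ S ⊆ E such that Iᵢ ∩ S spans S in Mᵢ for every i < κ. -/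
open Set

/-- A set `X` spans an element `e` in a matroid `M` if either `e ∈ X` or `e` lies in
the closure of `X` (equivalently, `{e}` is dependent in the contraction `M/X`).
`X` spans a set `S` if it spans every element of `S`. -/
def Matroid.Spans {α : Type*} (M : Matroid α) (X S : Set α) : Prop :=
  ∀ e ∈ S, e ∈ X ∨ e ∈ M.closure X

namespace Matroid

variable {α ι : Type*}

/-- The arcs of the exchange digraph of a family of independent sets: `f` lies in some `I i` and
may be replaced there by `e ∉ I i`. -/
def ExchangeArc (M : ι → Matroid α) (I : ι → Set α) (e f : α) : Prop :=
  ∃ i, e ∉ I i ∧ f ∈ I i ∧ (M i).Indep (insert e (I i \ {f}))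

/-- An element is addable if it can be added to some member of the family that
does not contain it. -/
def Addable (M : ι → Matroid α) (I : ι → Set α) (e : α) : Prop :=
  ∃ i, e ∉ I i ∧ (M i).Indep (insert e (I i))

open Classical in
/-- The family obtained from `I` by moving the element `f` into the member with index `j`. -/
def moveTo (I : ι → Set α) (j : ι) (f : α) (i : ι) : Set α :=
  if i = j then insert f (I i) else I i \ {f}

lemma moveTo_self (I : ι → Set α) (j : ι) (f : α) : moveTo I j f j = insert f (I j) :=
  if_pos rfl

lemma moveTo_of_ne (I : ι → Set α) {i j : ι} (f : α) (h : i ≠ j) :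
    moveTo I j f i = I i \ {f} :=
  if_neg h

lemma iUnion_moveTo (I : ι → Set α) (j : ι) (f : α) :
    ⋃ i, moveTo I j f i = insert f (⋃ i, I i) := by
  ext x
  simp only [mem_iUnion, mem_insert_iff]
  constructor
  · rintro ⟨i, hx⟩
    by_cases h : i = j
    · subst h
      rw [moveTo_self] at hx
      exact hx.imp id fun h ↦ ⟨i, h⟩
    · rw [moveTo_of_ne I f h] at hx
      exact Or.inr ⟨i, hx.1⟩
  · intro hx
    by_cases hxf : x = f
    · exact ⟨j, by simp [moveTo_self, hxf]⟩
    · obtain ⟨i, hi⟩ := hx.resolve_left hxf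
      refine ⟨i, ?_⟩
      by_cases h : i = j
      · subst h
        exact moveTo_self I i f ▸ Or.inr hi
      · exact moveTo_of_ne I f h ▸ ⟨hi, hxf⟩

lemma pairwise_disjoint_moveTo {I : ι → Set α} (hI : Pairwise (Function.onFun Disjoint I))
    (j : ι) (f : α) : Pairwise (Function.onFun Disjoint (moveTo I j f)) := by
  intro a b hab
  have h := Set.disjoint_left.1 (hI hab)
  refine Set.disjoint_left.2 fun x hxa hxb ↦ ?_
  unfold moveTo at hxa hxb
  split_ifs at hxa hxb <;> simp_all

lemma indep_moveTo {M : ι → Matroid α} {I : ι → Set α} (hI : ∀ i, (M i).Indep (I i)) {j : ι}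
    {f : α} (hf : (M j).Indep (insert f (I j))) (i : ι) : (M i).Indep (moveTo I j f i) := by
  by_cases h : i = j
  · subst h
    rwa [moveTo_self]
  · rw [moveTo_of_ne I f h]
    exact (hI i).subset sdiff_subset

/-- Moving an addable element preserves exchange arcs which avoid it and
whose tail is not addable. -/
lemma ExchangeArc.moveTo {M : ι → Matroid α} {I : ι → Set α} (hI : ∀ i, (M i).Indep (I i))
    {j : ι} {e f g : α} (hfj : f ∉ I j) (hf : (M j).Indep (insert f (I j)))
    (he : ¬ Addable M I e) (hef : e ≠ f) (hgf : g ≠ f) (h : ExchangeArc M I e g) :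
    ExchangeArc M (moveTo I j f) e g := by
  obtain ⟨i, hei, hgi, hind⟩ := h
  refine ⟨i, ?_⟩
  by_cases hij : i = j
  · subst hij
    rw [moveTo_self]
    refine ⟨by simp [hef, hei], by simp [hgi], ?_⟩
    have heE : e ∈ (M i).E := hind.subset_ground (mem_insert ..)
    have hecl : e ∈ (M i).closure (I i) := by
      by_contra hcl
      exact he ⟨i, hei, ((hI i).notMem_closure_iff_of_notMem hei heE).1 hcl⟩
    have hfcl : f ∉ (M i).closure (I i) :=
      ((hI i).notMem_closure_iff_of_notMem hfj (hf.subset_ground (mem_insert ..))).2 hf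
    have hsub : insert e (I i \ {g}) ⊆ (M i).closure (I i) :=
      insert_subset hecl (sdiff_subset.trans ((M i).subset_closure _ (hI i).subset_ground))
    have hfcl' : f ∉ (M i).closure (insert e (I i \ {g})) :=
      fun hmem ↦ hfcl ((M i).closure_subset_closure_of_subset_closure hsub hmem)
    have hins : (M i).Indep (insert f (insert e (I i \ {g}))) :=
      hind.insert_indep_iff.2 (Or.inl ⟨hf.subset_ground (mem_insert ..), hfcl'⟩)
    refine hins.subset ?_
    rw [insert_comm f e]
    exact insert_subset_insert fun x hx ↦ hx.1.imp id fun h ↦ ⟨h, hx.2⟩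
  · rw [moveTo_of_ne I f hij]
    exact ⟨fun h ↦ hei h.1, ⟨hgi, hgf⟩,
      hind.subset (insert_subset_insert (sdiff_subset_sdiff_left sdiff_subset))⟩

/-- A path in the exchange digraph that ends in an addable element allows its first element to be
added to the union of the family. -/
lemma exists_augmentation_of_path {M : ι → Matroid α} (p : ℕ → α) (n : ℕ) {I : ι → Set α}
    (hI : ∀ i, (M i).Indep (I i)) (hdisj : Pairwise (Function.onFun Disjoint I))
    (harc : ∀ k < n, ExchangeArc M I (p k) (p (k + 1))) (hn : Addable M I (p n)) :
    ∃ J : ι → Set α, Pairwise (Function.onFun Disjoint J) ∧ (∀ i, (M i).Indep (J i)) ∧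
      ⋃ i, J i = insert (p 0) (⋃ i, I i) := by
  induction n using Nat.strong_induction_on generalizing I with
  | _ n ih =>
  by_cases hk : ∃ k < n, Addable M I (p k)
  · obtain ⟨k, hkn, hk⟩ := hk
    exact ih k hkn hI hdisj (fun l hl ↦ harc l (hl.trans hkn)) hk
  push Not at hk
  obtain ⟨j, hj, hind⟩ := id hn
  cases n with
  | zero => exact ⟨moveTo I j (p 0), pairwise_disjoint_moveTo hdisj _ _, indep_moveTo hI hind,
      iUnion_moveTo I j (p 0)⟩
  | succ m =>
    have hne : ∀ k < m + 1, p k ≠ p (m + 1) := fun k hkm h ↦ hk k hkm (h ▸ hn)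
    obtain ⟨i, hei, hfi, hei'⟩ := harc m (Nat.lt_succ_self m)
    have hij : i ≠ j := by
      rintro rfl
      exact hj hfi
    have hadd : Addable M (moveTo I j (p (m + 1))) (p m) := by
      refine ⟨i, ?_⟩
      rw [moveTo_of_ne I _ hij]
      exact ⟨fun h ↦ hei h.1, hei'⟩
    obtain ⟨J, hJ, hJi, hJU⟩ := ih m (Nat.lt_succ_self m) (indep_moveTo hI hind)
      (pairwise_disjoint_moveTo hdisj j (p (m + 1)))
      (fun k hkm ↦ (harc k (hkm.trans (Nat.lt_succ_self m))).moveTo hI hj hind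
        (hk k (by lia)) (hne k (by lia)) (hne (k + 1) (by lia))) hadd
    refine ⟨J, hJ, hJi, ?_⟩
    rw [hJU, iUnion_moveTo, insert_eq_of_mem (mem_iUnion_of_mem i hfi)]

/-- If `e` is not addable, then it is spanned by the heads in `I i` of the arcs at `e`. -/
lemma mem_closure_inter_of_not_addable {M : ι → Matroid α} {I : ι → Set α} {S : Set α} {e : α}
    {i : ι} (hI : (M i).Indep (I i)) (heE : e ∈ (M i).E) (hei : e ∉ I i)
    (he : ¬ Addable M I e) (hS : ∀ f, ExchangeArc M I e f → f ∈ S) :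
    e ∈ (M i).closure (I i ∩ S) := by
  have hecl : e ∈ (M i).closure (I i) := by
    by_contra hcl
    exact he ⟨i, hei, (hI.notMem_closure_iff_of_notMem hei heE).1 hcl⟩
  have hC := hI.fundCircuit_isCircuit hecl hei
  refine (M i).closure_subset_closure ?_
    (hC.mem_closure_sdiff_singleton_of_mem ((M i).mem_fundCircuit e (I i)))
  rintro f ⟨hfC, hfe : f ≠ e⟩
  have hfI : f ∈ I i := ((M i).fundCircuit_subset_insert e (I i) hfC).resolve_left hfe
  refine ⟨hfI, hS f ⟨i, hei, hfI, ?_⟩⟩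
  rw [insert_sdiff_singleton_comm hfe.symm]
  exact (hI.mem_fundCircuit_iff hecl hei).1 hfC

end Matroid

open Matroid in

/-- **Lemma (Edmonds–Fulkerson augmenting path lemma).**
Let `M i` (for `i : ι`) be matroids on the common ground set `E`, and let `I i` be
pairwise disjoint sets with `I i` independent in `M i`, such that
`U := E \ ⋃ i, I i` is nonempty. Then either there are pairwise disjoint sets `J i`,
independent in the respective `M i`, covering exactly one more element `e ∈ U`; or
there is a set `S` with `U ⊆ S ⊆ E` such that `I i ∩ S` spans `S` in `M i` for
every `i`. -/
theorem edmonds_fulkerson_augmenting_path {α : Type*} {ι : Type*} (E : Set α)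
    (M : ι → Matroid α) (hE : ∀ i, (M i).E = E)
    (I : ι → Set α) (hI : ∀ i, (M i).Indep (I i))
    (hIdisj : Pairwise (Function.onFun Disjoint I))
    (hU : (E \ ⋃ i, I i).Nonempty) :
    (∃ (J : ι → Set α) (e : α), e ∈ E \ ⋃ i, I i ∧
        Pairwise (Function.onFun Disjoint J) ∧ (∀ i, (M i).Indep (J i)) ∧
        ⋃ i, J i = insert e (⋃ i, I i)) ∨
    (∃ S, E \ ⋃ i, I i ⊆ S ∧ S ⊆ E ∧ ∀ i, (M i).Spans (I i ∩ S) S) := by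
  let S : Set α := {e | ∃ (p : ℕ → α) (n : ℕ), p 0 ∈ E \ ⋃ i, I i ∧
    (∀ k < n, ExchangeArc M I (p k) (p (k + 1))) ∧ p n = e}
  by_cases hadd : ∃ e ∈ S, Addable M I e
  · obtain ⟨_, ⟨p, n, hp, harc, rfl⟩, hn⟩ := hadd
    obtain ⟨J, hJ⟩ := exists_augmentation_of_path p n hI hIdisj harc hn
    exact Or.inl ⟨J, p 0, hp, hJ⟩
  push Not at hadd
  have hSE : S ⊆ E := by
    rintro _ ⟨p, n, hp, harc, rfl⟩
    cases n with
    | zero => exact hp.1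
    | succ m =>
      obtain ⟨i, -, hi, -⟩ := harc m (Nat.lt_succ_self m)
      exact hE i ▸ (hI i).subset_ground hi
  have hstep : ∀ e ∈ S, ∀ f, ExchangeArc M I e f → f ∈ S := by
    rintro _ ⟨p, n, hp, harc, rfl⟩ f hf
    refine ⟨fun k ↦ if k ≤ n then p k else f, n + 1, by simpa using hp, fun k hk ↦ ?_, by simp⟩
    obtain rfl | hkn := (Nat.lt_succ_iff.1 hk).eq_or_lt
    · simpa using hf
    · simpa [hkn.le, Nat.succ_le_of_lt hkn] using harc k hkn
  refine Or.inr ⟨S, fun e he ↦ ⟨fun _ ↦ e, 0, he, by simp, rfl⟩, hSE, fun i e he ↦ ?_⟩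
  by_cases hei : e ∈ I i
  · exact Or.inl ⟨hei, he⟩
  · exact Or.inr (mem_closure_inter_of_not_addable (hI i) (hE i ▸ hSE he) hei (hadd e he)
      (hstep e he))
end
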